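/- Sparse grid formula for the kriging predictive variance (equation (4)): Assume every matrix S_{i,j} for 1 ≤ i ≤ d and 1 ≤ j ≤ η−d+1 is positive definite and that Σ is positive definite. Fix x_0 ∈ ℝ^d and let σ(x_0) = (C(x_0, x))_{x ∈ X_SG(η)}. For each i and j ≥ 1 define ε_{i,j}(x_0) = C_i(x_0^{(i)}, x_0^{(i)}) − s_{i,j}(x_0^{(i)})ᵀ S_{i,j}^{-1} s_{i,j}(x_0^{(i)}), where s_{i,j}(t) = (C_i(t, x))_{x ∈ X_{i,j}}, set ε_{i,0}(x_0) = C_i(x_0^{(i)}, x_0^{(i)}), and let Δ_{i,j}(x_0) = ε_{i,j−1}(x_0) − ε_{i,j}(x_0). Then C(x_0, x_0) − σ(x_0)ᵀ Σ^{-1} σ(x_0) = C(x_0, x_0) − Σ_{j ∈ J(η)} ∏_{i=1}^d Δ_{i,j_i}(x_0); equivalently σ(x_0)ᵀ Σ^{-1} σ(x_0) = Σ_{j ∈ J(η)} ∏_{i=1}^d Δ_{i,j_i}(x_0). -/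

import Mathlib

open Finset Matrix

noncomputable section

/-- Multi-indices `j ∈ ℕ^d` with all entries at least 1 and `∑ j i = η`. -/
def idxE (d η : ℕ) : Finset (Fin d → ℕ) :=
  (Fintype.piFinset fun _ : Fin d => Finset.Icc 1 η).filter fun j => ∑ i, j i = η

/-- The index set `J(η)`: multi-indices with all entries at least 1 and `∑ j i ≤ η`. -/
def idxJ (d η : ℕ) : Finset (Fin d → ℕ) :=
  (Fintype.piFinset fun _ : Fin d => Finset.Icc 1 η).filter fun j => ∑ i, j i ≤ η

/-- The lattice design `X_{1,j_1} × ⋯ × X_{d,j_d}`. -/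
def lattice {d : ℕ} (X : Fin d → ℕ → Finset ℝ) (j : Fin d → ℕ) : Finset (Fin d → ℝ) :=
  Fintype.piFinset fun i => X i (j i)

/-- The sparse grid design `X_SG(η)`. -/
def sparseGrid {d : ℕ} (X : Fin d → ℕ → Finset ℝ) (η : ℕ) : Finset (Fin d → ℝ) :=
  (idxE d η).biUnion fun j => lattice X j

/-- The component covariance matrix `S_{i,j} = (C_i(x,x'))_{x,x' ∈ X_{i,j}}`. -/
def Smat {d : ℕ} (X : Fin d → ℕ → Finset ℝ) (C : Fin d → ℝ → ℝ → ℝ) (i : Fin d) (j : ℕ) :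
    Matrix ↥(X i j) ↥(X i j) ℝ :=
  Matrix.of fun x y => C i x.1 y.1

/-- The covariance matrix `Σ = (∏ i, C_i(x^{(i)}, y^{(i)}))_{x,y ∈ X_SG(η)}`. -/
def SigmaMat {d : ℕ} (X : Fin d → ℕ → Finset ℝ) (C : Fin d → ℝ → ℝ → ℝ) (η : ℕ) :
    Matrix ↥(sparseGrid X η) ↥(sparseGrid X η) ℝ :=
  Matrix.of fun x y => ∏ i, C i (x.1 i) (y.1 i)

/-- The one-dimensional expected squared prediction error
`ε_{i,j}(x₀) = C_i(x₀^{(i)}, x₀^{(i)}) − s_{i,j}(x₀^{(i)})ᵀ S_{i,j}^{-1} s_{i,j}(x₀^{(i)})`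
(with `ε_{i,0}(x₀) = C_i(x₀^{(i)}, x₀^{(i)})` automatic since `X_{i,0} = ∅`). -/
def epsSG {d : ℕ} (X : Fin d → ℕ → Finset ℝ) (C : Fin d → ℝ → ℝ → ℝ)
    (x₀ : Fin d → ℝ) (i : Fin d) (j : ℕ) : ℝ :=
  C i (x₀ i) (x₀ i) -
    ∑ x : ↥(X i j), ∑ y : ↥(X i j),
      C i (x₀ i) x.1 * (Smat X C i j)⁻¹ x y * C i (x₀ i) y.1

/-- `Δ_{i,j}(x₀) = ε_{i,j−1}(x₀) − ε_{i,j}(x₀)`. -/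
def deltaSG {d : ℕ} (X : Fin d → ℕ → Finset ℝ) (C : Fin d → ℝ → ℝ → ℝ)
    (x₀ : Fin d → ℝ) (i : Fin d) (j : ℕ) : ℝ :=
  epsSG X C x₀ i (j - 1) - epsSG X C x₀ i j

/-- The one-dimensional simple kriging weights `S_{i,j}^{-1} s_{i,j}(x₀^{(i)})`, extended by zero
outside `X_{i,j}`. -/
def krigingWeight {d : ℕ} (X : Fin d → ℕ → Finset ℝ) (C : Fin d → ℝ → ℝ → ℝ)
    (x₀ : Fin d → ℝ) (i : Fin d) (j : ℕ) (t : ℝ) : ℝ :=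
  if h : t ∈ X i j then
    ((Smat X C i j)⁻¹ *ᵥ fun x : ↥(X i j) => C i (x₀ i) x.1) ⟨t, h⟩
  else 0

/-- The linear functional on functions given by the one-dimensional kriging weights. -/
def krigingFunctional {d : ℕ} (X : Fin d → ℕ → Finset ℝ) (C : Fin d → ℝ → ℝ → ℝ)
    (x₀ : Fin d → ℝ) (i : Fin d) (j : ℕ) (g : ℝ → ℝ) : ℝ :=
  ∑ t ∈ X i j, g t * krigingWeight X C x₀ i j t

/-- The sparse grid kriging weights. -/
def sparseGridWeight {d : ℕ} (X : Fin d → ℕ → Finset ℝ) (C : Fin d → ℝ → ℝ → ℝ)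
    (x₀ : Fin d → ℝ) (η : ℕ) (x : Fin d → ℝ) : ℝ :=
  ∑ j ∈ idxJ d η, ∏ i,
    (krigingWeight X C x₀ i (j i) (x i) - krigingWeight X C x₀ i (j i - 1) (x i))

section

variable {d η : ℕ} {X : Fin d → ℕ → Finset ℝ} {C : Fin d → ℝ → ℝ → ℝ} {x₀ : Fin d → ℝ}
  {i : Fin d}

theorem mem_idxJ {j : Fin d → ℕ} : j ∈ idxJ d η ↔ (∀ i, 1 ≤ j i) ∧ ∑ i, j i ≤ η := by
  simp only [idxJ, Finset.mem_filter, Fintype.mem_piFinset, Finset.mem_Icc]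
  refine ⟨fun h => ⟨fun i => (h.1 i).1, h.2⟩, fun h => ⟨fun i => ⟨h.1 i, ?_⟩, h.2⟩⟩
  exact (Finset.single_le_sum (fun _ _ => Nat.zero_le _) (Finset.mem_univ i)).trans h.2

theorem mem_idxE {j : Fin d → ℕ} : j ∈ idxE d η ↔ (∀ i, 1 ≤ j i) ∧ ∑ i, j i = η := by
  simp only [idxE, Finset.mem_filter, Fintype.mem_piFinset, Finset.mem_Icc]
  refine ⟨fun h => ⟨fun i => (h.1 i).1, h.2⟩, fun h => ⟨fun i => ⟨h.1 i, ?_⟩, h.2⟩⟩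
  exact (Finset.single_le_sum (fun _ _ => Nat.zero_le _) (Finset.mem_univ i)).trans h.2.le

theorem le_of_mem_idxJ {j : Fin d → ℕ} (hj : j ∈ idxJ d η) (i : Fin d) : j i ≤ η - d + 1 := by
  rw [mem_idxJ] at hj
  have h₁ : ∑ k ∈ Finset.univ.erase i, 1 ≤ ∑ k ∈ Finset.univ.erase i, j k :=
    Finset.sum_le_sum fun k _ => hj.1 k
  have h₂ := Finset.add_sum_erase Finset.univ j (Finset.mem_univ i)
  simp only [Finset.sum_const, Finset.card_erase_of_mem (Finset.mem_univ i), Finset.card_univ,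
    Fintype.card_fin, smul_eq_mul, mul_one] at h₁
  have := hj.2
  omega

theorem exists_le_mem_idxE (hd : 1 ≤ d) {j : Fin d → ℕ} (hj : j ∈ idxJ d η) :
    ∃ k ∈ idxE d η, j ≤ k := by
  rw [mem_idxJ] at hj
  let i₀ : Fin d := ⟨0, hd⟩
  have hle : j ≤ j + Pi.single i₀ (η - ∑ i, j i) := le_self_add
  refine ⟨j + Pi.single i₀ (η - ∑ i, j i), mem_idxE.2 ⟨fun i => (hj.1 i).trans (hle i), ?_⟩, hle⟩
  simp only [Pi.add_apply, Finset.sum_add_distrib, Finset.sum_pi_single', Finset.mem_univ, if_true]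
  omega

theorem lattice_subset_sparseGrid (hd : 1 ≤ d) (hX : ∀ i, Monotone (X i)) {j : Fin d → ℕ}
    (hj : j ∈ idxJ d η) : lattice X j ⊆ sparseGrid X η := by
  obtain ⟨k, hk, hjk⟩ := exists_le_mem_idxE hd hj
  refine fun x hx => Finset.mem_biUnion.2 ⟨k, hk, ?_⟩
  rw [lattice, Fintype.mem_piFinset] at hx ⊢
  exact fun i => hX i (hjk i) (hx i)

theorem sparseGrid_subset (hX : ∀ i, Monotone (X i)) :
    sparseGrid X η ⊆ Fintype.piFinset fun i => X i η := by
  intro x hx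
  obtain ⟨k, hk, hxk⟩ := Finset.mem_biUnion.1 hx
  rw [lattice, Fintype.mem_piFinset] at hxk
  refine Fintype.mem_piFinset.2 fun i => hX i ?_ (hxk i)
  rw [← (mem_idxE.1 hk).2]
  exact Finset.single_le_sum (fun _ _ => Nat.zero_le _) (Finset.mem_univ i)

theorem krigingWeight_of_notMem {j : ℕ} {t : ℝ} (h : t ∉ X i j) :
    krigingWeight X C x₀ i j t = 0 :=
  dif_neg h

theorem sum_mul_krigingWeight {j : ℕ} {D : Finset ℝ} (hD : X i j ⊆ D) (g : ℝ → ℝ) :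
    ∑ t ∈ D, g t * krigingWeight X C x₀ i j t = krigingFunctional X C x₀ i j g :=
  (Finset.sum_subset hD fun t _ ht => by rw [krigingWeight_of_notMem ht, mul_zero]).symm

theorem krigingFunctional_eq_sum (j : ℕ) (g : ℝ → ℝ) :
    krigingFunctional X C x₀ i j g =
      ∑ x : ↥(X i j), g x.1 *
        ((Smat X C i j)⁻¹ *ᵥ fun x : ↥(X i j) => C i (x₀ i) x.1) x := by
  rw [krigingFunctional, ← Finset.sum_coe_sort]
  exact Finset.sum_congr rfl fun x _ => by rw [krigingWeight, dif_pos x.2]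

theorem krigingFunctional_of_eq_empty {j : ℕ} (h : X i j = ∅) (g : ℝ → ℝ) :
    krigingFunctional X C x₀ i j g = 0 := by
  rw [krigingFunctional, h, Finset.sum_empty]

/-- The kriging functional reproduces the covariances at the design points. -/
theorem krigingFunctional_cov {j : ℕ} (hS : (Smat X C i j).PosDef) {y : ℝ} (hy : y ∈ X i j) :
    krigingFunctional X C x₀ i j (C i y) = C i (x₀ i) y := by
  have h : Smat X C i j *ᵥ ((Smat X C i j)⁻¹ *ᵥ fun x : ↥(X i j) => C i (x₀ i) x.1) =
      fun x : ↥(X i j) => C i (x₀ i) x.1 := by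
    rw [mulVec_mulVec, mul_nonsing_inv _ ((isUnit_iff_isUnit_det _).1 hS.isUnit), one_mulVec]
  rw [krigingFunctional_eq_sum]
  exact congrFun h ⟨y, hy⟩

theorem epsSG_eq_sub_krigingFunctional (j : ℕ) :
    epsSG X C x₀ i j = C i (x₀ i) (x₀ i) - krigingFunctional X C x₀ i j (C i (x₀ i)) := by
  rw [epsSG, krigingFunctional_eq_sum]
  simp only [mulVec, dotProduct, Finset.mul_sum, mul_assoc]

theorem sparseGridWeight_of_notMem (hd : 1 ≤ d) (hX : ∀ i, Monotone (X i)) {x : Fin d → ℝ}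
    (hx : x ∉ sparseGrid X η) : sparseGridWeight X C x₀ η x = 0 := by
  refine Finset.sum_eq_zero fun j hj => ?_
  have hxj : x ∉ lattice X j := fun h => hx (lattice_subset_sparseGrid hd hX hj h)
  rw [lattice, Fintype.mem_piFinset, not_forall] at hxj
  obtain ⟨i, hi⟩ := hxj
  refine Finset.prod_eq_zero (Finset.mem_univ i) ?_
  rw [krigingWeight_of_notMem hi,
    krigingWeight_of_notMem fun h => hi (hX i (Nat.sub_le _ _) h), sub_zero]

theorem sum_prod_mul_sparseGridWeight (hd : 1 ≤ d) (hX : ∀ i, Monotone (X i))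
    (g : Fin d → ℝ → ℝ) :
    ∑ x : ↥(sparseGrid X η), (∏ i, g i (x.1 i)) * sparseGridWeight X C x₀ η x.1 =
      ∑ j ∈ idxJ d η, ∏ i, (krigingFunctional X C x₀ i (j i) (g i) -
        krigingFunctional X C x₀ i (j i - 1) (g i)) := by
  rw [Finset.sum_coe_sort (sparseGrid X η)
      fun x => (∏ i, g i (x i)) * sparseGridWeight X C x₀ η x,
    Finset.sum_subset (sparseGrid_subset hX) fun x _ hx => by
      rw [sparseGridWeight_of_notMem hd hX hx, mul_zero]]
  simp only [sparseGridWeight, Finset.mul_sum, ← Finset.prod_mul_distrib]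
  rw [Finset.sum_comm]
  refine Finset.sum_congr rfl fun j hj => ?_
  rw [← Finset.prod_univ_sum (fun i => X i η) fun i t =>
    g i t * (krigingWeight X C x₀ i (j i) t - krigingWeight X C x₀ i (j i - 1) t)]
  refine Finset.prod_congr rfl fun i _ => ?_
  have hji : j i ≤ η :=
    (Finset.single_le_sum (fun _ _ => Nat.zero_le _) (Finset.mem_univ i)).trans (mem_idxJ.1 hj).2
  simp only [mul_sub, Finset.sum_sub_distrib]
  rw [sum_mul_krigingWeight (hX i hji), sum_mul_krigingWeight (hX i ((Nat.sub_le _ _).trans hji))]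

/-- The increments of the kriging functionals, applied to the covariances with a sparse grid
point, sum up to the covariance of that point with `x₀`. -/
theorem sum_prod_krigingFunctional_cov (hX0 : ∀ i, X i 0 = ∅) (hX : ∀ i, Monotone (X i))
    (hS : ∀ (i : Fin d) (j : ℕ), 1 ≤ j → j ≤ η - d + 1 → (Smat X C i j).PosDef)
    {y : Fin d → ℝ} (hy : y ∈ sparseGrid X η) :
    ∑ j ∈ idxJ d η, ∏ i, (krigingFunctional X C x₀ i (j i) (C i (y i)) -
        krigingFunctional X C x₀ i (j i - 1) (C i (y i))) = ∏ i, C i (x₀ i) (y i) := by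
  obtain ⟨k, hk, hyk⟩ := Finset.mem_biUnion.1 hy
  rw [lattice, Fintype.mem_piFinset] at hyk
  obtain ⟨hk₁, hk₂⟩ := mem_idxE.1 hk
  have hkJ : k ∈ idxJ d η := mem_idxJ.2 ⟨hk₁, hk₂.le⟩
  have hcov : ∀ i j, k i ≤ j → j ≤ η - d + 1 →
      krigingFunctional X C x₀ i j (C i (y i)) = C i (x₀ i) (y i) := fun i j hkj hj =>
    krigingFunctional_cov (hS i j ((hk₁ i).trans hkj) hj) (hX i hkj (hyk i))
  have hsub : (Fintype.piFinset fun i => Finset.Icc 1 (k i)) ⊆ idxJ d η := by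
    intro j hj
    simp only [Fintype.mem_piFinset, Finset.mem_Icc] at hj
    exact mem_idxJ.2 ⟨fun i => (hj i).1, hk₂ ▸ Finset.sum_le_sum fun i _ => (hj i).2⟩
  rw [← Finset.sum_subset hsub, ← Finset.prod_univ_sum (fun i => Finset.Icc 1 (k i)) fun i j =>
    krigingFunctional X C x₀ i j (C i (y i)) - krigingFunctional X C x₀ i (j - 1) (C i (y i))]
  · refine Finset.prod_congr rfl fun i _ => ?_
    rw [← hcov i (k i) le_rfl (le_of_mem_idxJ hkJ i), ← Finset.Ico_add_one_right_eq_Icc,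
      Finset.sum_Ico_eq_sum_range]
    simp only [Nat.add_sub_cancel, Nat.add_comm 1]
    rw [Finset.sum_range_sub fun n => krigingFunctional X C x₀ i n (C i (y i)),
      krigingFunctional_of_eq_empty (hX0 i), sub_zero]
  · intro j hj hjk
    simp only [Fintype.mem_piFinset, Finset.mem_Icc, not_forall, not_and, not_le] at hjk
    obtain ⟨i, hi⟩ := hjk
    have hki := hi ((mem_idxJ.1 hj).1 i)
    have hji := le_of_mem_idxJ hj i
    refine Finset.prod_eq_zero (Finset.mem_univ i) ?_
    rw [hcov i _ hki.le hji, hcov i _ (Nat.le_sub_one_of_lt hki) ((Nat.sub_le _ _).trans hji),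
      sub_self]

end

/-- **Sparse grid formula for the kriging predictive variance** (equation (4)):
`σ(x₀)ᵀ Σ^{-1} σ(x₀) = Σ_{j ∈ J(η)} ∏_i Δ_{i,j_i}(x₀)`; equivalently,
`C(x₀,x₀) − σ(x₀)ᵀ Σ^{-1} σ(x₀) = C(x₀,x₀) − Σ_{j ∈ J(η)} ∏_i Δ_{i,j_i}(x₀)`. -/
theorem sparse_grid_predictive_variance (d η : ℕ) (hd : 1 ≤ d) (hη : d ≤ η)
    (X : Fin d → ℕ → Finset ℝ) (hX0 : ∀ i, X i 0 = ∅)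
    (hnest : ∀ i j, X i j ⊆ X i (j + 1))
    (C : Fin d → ℝ → ℝ → ℝ)
    (hS : ∀ (i : Fin d) (j : ℕ), 1 ≤ j → j ≤ η - d + 1 → (Smat X C i j).PosDef)
    (hSigma : (SigmaMat X C η).PosDef)
    (x₀ : Fin d → ℝ) :
    ((∏ i, C i (x₀ i) (x₀ i)) -
        (fun x : ↥(sparseGrid X η) => ∏ i, C i (x₀ i) (x.1 i)) ⬝ᵥ
          ((SigmaMat X C η)⁻¹ *ᵥ fun x : ↥(sparseGrid X η) => ∏ i, C i (x₀ i) (x.1 i)) =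
        (∏ i, C i (x₀ i) (x₀ i)) -
          ∑ j ∈ idxJ d η, ∏ i : Fin d, deltaSG X C x₀ i (j i)) ∧
      (fun x : ↥(sparseGrid X η) => ∏ i, C i (x₀ i) (x.1 i)) ⬝ᵥ
          ((SigmaMat X C η)⁻¹ *ᵥ fun x : ↥(sparseGrid X η) => ∏ i, C i (x₀ i) (x.1 i)) =
        ∑ j ∈ idxJ d η, ∏ i : Fin d, deltaSG X C x₀ i (j i) := by
  have hX : ∀ i, Monotone (X i) := fun i => monotone_nat_of_le_succ (hnest i)
  have hsolve : (SigmaMat X C η)⁻¹ *ᵥ (fun x : ↥(sparseGrid X η) => ∏ i, C i (x₀ i) (x.1 i)) =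
      fun x => sparseGridWeight X C x₀ η x.1 := by
    have h : SigmaMat X C η *ᵥ (fun x => sparseGridWeight X C x₀ η x.1) =
        fun x : ↥(sparseGrid X η) => ∏ i, C i (x₀ i) (x.1 i) := by
      ext y
      exact (sum_prod_mul_sparseGridWeight hd hX fun i => C i (y.1 i)).trans
        (sum_prod_krigingFunctional_cov hX0 hX hS y.2)
    rw [← h, mulVec_mulVec, nonsing_inv_mul _ ((isUnit_iff_isUnit_det _).1 hSigma.isUnit),
      one_mulVec]
  have hvar : (fun x : ↥(sparseGrid X η) => ∏ i, C i (x₀ i) (x.1 i)) ⬝ᵥ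
        ((SigmaMat X C η)⁻¹ *ᵥ fun x : ↥(sparseGrid X η) => ∏ i, C i (x₀ i) (x.1 i)) =
      ∑ j ∈ idxJ d η, ∏ i : Fin d, deltaSG X C x₀ i (j i) := by
    rw [hsolve]
    refine (sum_prod_mul_sparseGridWeight hd hX fun i => C i (x₀ i)).trans ?_
    simp only [deltaSG, epsSG_eq_sub_krigingFunctional, sub_sub_sub_cancel_left]
  exact ⟨by rw [hvar], hvar⟩
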